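/- (Equivalence of Dirichlet forms, second estimate.) Let s : ℤ → ℝ be a symmetric transition probability, let μ_{1/2} be the Bernoulli product measure of density 1/2 on Ω = {0,1}^ℤ, and let h ∈ L²(μ_{1/2}). Suppose there exist m ∈ ℕ and a sequence x₀ = 0, x₁, …, x_m = 1 in ℤ with s(x_i − x_{i−1}) > 0 for all i ∈ {1,…,m} (which holds whenever s is irreducible). Then, with 𝒟(h) := (1/2) ∑_{x∈ℤ} I_{x,x+1}(h) and ⟨h, −Sh⟩ := (1/2) ∑_{x∈ℤ} ∑_{z>0} s(z) I_{x,x+z}(h), one has 𝒟(h) ≤ C₂ ⟨h, −Sh⟩ with C₂ := (4m − 3) m / min_{1≤i≤m} s(x_i − x_{i−1}). -/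

import Mathlib

open MeasureTheory

/-- The configuration obtained from `η` by exchanging the values at `x` and `y`. -/
def swapConf (x y : ℤ) (η : ℤ → Bool) : ℤ → Bool :=
  fun w => if w = x then η y else if w = y then η x else η w

/-- `I_{x,y}(h) = ∫ (h(η^{x,y}) − h(η))² dμ`. -/
noncomputable def Ixy (μ : Measure (ℤ → Bool)) (h : (ℤ → Bool) → ℝ) (x y : ℤ) : ℝ :=
  ∫ η, (h (swapConf x y η) - h η) ^ 2 ∂μ

/-- The Dirichlet form `𝒟(h) = ½ ∑_{x∈ℤ} I_{x,x+1}(h)`, with values in `[0,∞]`. -/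
noncomputable def dirichletForm (μ : Measure (ℤ → Bool)) (h : (ℤ → Bool) → ℝ) : ENNReal :=
  (1 / 2 : ENNReal) * ∑' x : ℤ, ENNReal.ofReal (Ixy μ h x (x + 1))

/-- `⟨h, −Sh⟩ = ½ ∑_{x∈ℤ} ∑_{z>0} s(z) I_{x,x+z}(h)`, with values in `[0,∞]`. -/
noncomputable def genForm (s : ℤ → ℝ) (μ : Measure (ℤ → Bool)) (h : (ℤ → Bool) → ℝ) : ENNReal :=
  (1 / 2 : ENNReal) * ∑' x : ℤ, ∑' z : ℕ,
    ENNReal.ofReal (s ((z : ℤ) + 1)) * ENNReal.ofReal (Ixy μ h x (x + ((z : ℤ) + 1)))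


lemma swapConf_eq (x y : ℤ) (η : ℤ → Bool) : swapConf x y η = η ∘ (Equiv.swap x y) := by
  funext w
  simp only [swapConf, Function.comp, Equiv.swap_apply_def]
  split_ifs <;> rfl

def IsBern (μ : Measure (ℤ → Bool)) : Prop :=
  ∀ (S : Finset ℤ) (b : ℤ → Bool), μ {η | ∀ x ∈ S, η x = b x} = (1 / 2 : ENNReal) ^ S.card

lemma mp_perm (μ : Measure (ℤ → Bool)) [IsProbabilityMeasure μ] (hμ : IsBern μ)
    (σ : Equiv.Perm ℤ) : MeasurePreserving (fun η : ℤ → Bool => η ∘ σ) μ μ := by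
  have hmeas : Measurable (fun η : ℤ → Bool => η ∘ σ) :=
    measurable_pi_iff.2 fun a => measurable_pi_apply (σ a)
  refine ⟨hmeas, ?_⟩
  have hcyl : ∀ (S : Finset ℤ) (b : ℤ → Bool),
      MeasurableSet {η : ℤ → Bool | ∀ x ∈ S, η x = b x} := by
    intro S b
    have : {η : ℤ → Bool | ∀ x ∈ S, η x = b x} = ⋂ x ∈ S, (fun η => η x) ⁻¹' {b x} := by
      ext; simp
    rw [this]
    exact Finset.measurableSet_biInter _ fun x _ => measurable_pi_apply x (measurableSet_singleton _)
  let C : Set (Set (ℤ → Bool)) :=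
    {A | ∃ (S : Finset ℤ) (b : ℤ → Bool), A = {η | ∀ x ∈ S, η x = b x}}
  haveI : IsProbabilityMeasure (μ.map (fun η : ℤ → Bool => η ∘ σ)) :=
    Measure.isProbabilityMeasure_map hmeas.aemeasurable
  refine ext_of_generate_finite C ?_ ?_ ?_ (by simp)
  · apply le_antisymm
    · refine iSup_le fun a => ?_
      rw [← measurable_iff_comap_le]
      refine @measurable_to_bool _ (MeasurableSpace.generateFrom C) _ ?_
      refine MeasurableSpace.measurableSet_generateFrom ⟨{a}, fun _ => true, ?_⟩
      ext; simp
    · refine MeasurableSpace.generateFrom_le ?_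
      rintro _ ⟨S, b, rfl⟩
      exact hcyl S b
  · rintro _ ⟨S, b, rfl⟩ _ ⟨S', b', rfl⟩ ⟨η0, h1, h2⟩
    refine ⟨S ∪ S', η0, ?_⟩
    simp only [Set.mem_ofPred_eq] at h1 h2
    ext η
    simp only [Set.mem_inter_iff, Set.mem_ofPred_eq, Finset.mem_union]
    constructor
    · rintro ⟨h3, h4⟩ x (hx | hx)
      · rw [h3 x hx, h1 x hx]
      · rw [h4 x hx, h2 x hx]
    · intro h3
      exact ⟨fun x hx => by rw [h3 x (Or.inl hx), h1 x hx],
        fun x hx => by rw [h3 x (Or.inr hx), h2 x hx]⟩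
  · rintro _ ⟨S, b, rfl⟩
    rw [Measure.map_apply hmeas (hcyl S b)]
    have : (fun η : ℤ → Bool => η ∘ σ) ⁻¹' {η | ∀ x ∈ S, η x = b x}
        = {η | ∀ x ∈ S.map σ.toEmbedding, η x = (b ∘ σ.symm) x} := by
      ext η
      simp only [Set.mem_preimage, Set.mem_ofPred_eq, Finset.forall_mem_map]
      simp
    rw [this, hμ, hμ, Finset.card_map]

noncomputable def Nrm (μ : Measure (ℤ → Bool)) (h : (ℤ → Bool) → ℝ) (σ : Equiv.Perm ℤ) : ℝ :=
  (eLpNorm (fun η => h (η ∘ σ) - h η) 2 μ).toReal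


lemma memLp_perm (μ : Measure (ℤ → Bool)) [IsProbabilityMeasure μ] (hμ : IsBern μ)
    (h : (ℤ → Bool) → ℝ) (hh : MemLp h 2 μ) (σ : Equiv.Perm ℤ) :
    MemLp (fun η => h (η ∘ σ) - h η) 2 μ :=
  (hh.comp_measurePreserving (mp_perm μ hμ σ)).sub hh

lemma Nrm_sq (μ : Measure (ℤ → Bool)) [IsProbabilityMeasure μ] (hμ : IsBern μ)
    (h : (ℤ → Bool) → ℝ) (hh : MemLp h 2 μ) (x y : ℤ) :
    Nrm μ h (Equiv.swap x y) ^ 2 = Ixy μ h x y := by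
  have hm := memLp_perm μ hμ h hh (Equiv.swap x y)
  unfold Nrm Ixy
  rw [hm.eLpNorm_eq_integral_rpow_norm (by norm_num) (by norm_num)]
  have hnn : 0 ≤ ∫ η, (h (swapConf x y η) - h η) ^ 2 ∂μ := integral_nonneg fun _ => sq_nonneg _
  have : (∫ a, ‖h (a ∘ (Equiv.swap x y)) - h a‖ ^ (2 : ENNReal).toReal ∂μ)
      = ∫ η, (h (swapConf x y η) - h η) ^ 2 ∂μ := by
    congr 1; funext η; simp [swapConf_eq]
  rw [this, ENNReal.toReal_ofReal (by positivity)]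
  rw [← Real.rpow_natCast, ← Real.rpow_mul hnn]
  simp

lemma Nrm_mul (μ : Measure (ℤ → Bool)) [IsProbabilityMeasure μ] (hμ : IsBern μ)
    (h : (ℤ → Bool) → ℝ) (hh : MemLp h 2 μ) (σ τ : Equiv.Perm ℤ) :
    Nrm μ h (σ * τ) ≤ Nrm μ h σ + Nrm μ h τ := by
  have h1 := memLp_perm μ hμ h hh σ
  have h2 := memLp_perm μ hμ h hh τ
  have h3 := h2.comp_measurePreserving (mp_perm μ hμ σ)
  have e : eLpNorm ((fun η => h (η ∘ τ) - h η) ∘ (fun η : ℤ → Bool => η ∘ σ)) 2 μ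
      = eLpNorm (fun η => h (η ∘ τ) - h η) 2 μ :=
    eLpNorm_comp_measurePreserving h2.1 (mp_perm μ hμ σ)
  unfold Nrm
  rw [← e, ← ENNReal.toReal_add h1.2.ne h3.2.ne]
  refine ENNReal.toReal_mono (ENNReal.add_ne_top.2 ⟨h1.2.ne, h3.2.ne⟩) ?_
  refine le_trans (le_of_eq ?_) (eLpNorm_add_le h1.1 h3.1 (by norm_num))
  congr 1
  funext η
  simp only [Pi.add_apply, Function.comp_def, Equiv.Perm.mul_apply]
  ring

lemma Nrm_nonneg (μ : Measure (ℤ → Bool)) (h : (ℤ → Bool) → ℝ) (σ : Equiv.Perm ℤ) :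
    0 ≤ Nrm μ h σ := ENNReal.toReal_nonneg

lemma Nrm_one (μ : Measure (ℤ → Bool)) (h : (ℤ → Bool) → ℝ) : Nrm μ h 1 = 0 := by
  simp [Nrm]

lemma Nrm_tri (μ : Measure (ℤ → Bool)) [IsProbabilityMeasure μ] (hμ : IsBern μ)
    (h : (ℤ → Bool) → ℝ) (hh : MemLp h 2 μ) (x y z : ℤ) :
    Nrm μ h (Equiv.swap x z) ≤ Nrm μ h (Equiv.swap x y) + 2 * Nrm μ h (Equiv.swap y z) := by
  have p1 := Nrm_nonneg μ h (Equiv.swap x y)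
  have p2 := Nrm_nonneg μ h (Equiv.swap y z)
  by_cases hxz : x = z
  · subst hxz
    rw [Equiv.swap_self, show Equiv.refl ℤ = 1 from rfl, Nrm_one]; linarith
  by_cases hxy : x = y
  · subst hxy; linarith
  have := Equiv.swap_mul_swap_mul_swap hxy hxz
  rw [Equiv.swap_comm x z, ← this]
  have a := Nrm_mul μ hμ h hh (Equiv.swap y z * Equiv.swap x y) (Equiv.swap y z)
  have b := Nrm_mul μ hμ h hh (Equiv.swap y z) (Equiv.swap x y)
  linarith

lemma Nrm_path (μ : Measure (ℤ → Bool)) [IsProbabilityMeasure μ] (hμ : IsBern μ)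
    (h : (ℤ → Bool) → ℝ) (hh : MemLp h 2 μ) (w : ℕ → ℤ) (m : ℕ) :
    Nrm μ h (Equiv.swap (w 0) (w m)) ≤
      ∑ i ∈ Finset.range m, (if i = 0 then 1 else 2) * Nrm μ h (Equiv.swap (w i) (w (i+1))) := by
  induction m with
  | zero => simp [Equiv.swap_self, show Equiv.refl ℤ = 1 from rfl, Nrm_one]
  | succ k ih =>
    rw [Finset.sum_range_succ]
    by_cases hk : k = 0
    · subst hk; simp
    · rw [if_neg hk]
      exact (Nrm_tri μ hμ h hh (w 0) (w k) (w (k+1))).trans (by linarith)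

lemma sum_c (m : ℕ) (hm : 1 ≤ m) :
    ∑ i ∈ Finset.range m, (if i = 0 then (1:ℝ) else 2) = 2 * m - 1 := by
  induction m, hm using Nat.le_induction with
  | base => norm_num
  | succ k hk ih =>
    rw [Finset.sum_range_succ, ih, if_neg (by omega)]; push_cast; ring

lemma I_path (μ : Measure (ℤ → Bool)) [IsProbabilityMeasure μ] (hμ : IsBern μ)
    (h : (ℤ → Bool) → ℝ) (hh : MemLp h 2 μ) (w : ℕ → ℤ) (m : ℕ) (hm : 1 ≤ m) :
    Ixy μ h (w 0) (w m) ≤ (2 * m - 1) *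
      ∑ i ∈ Finset.range m, (if i = 0 then 1 else 2) * Ixy μ h (w i) (w (i+1)) := by
  have h0 := Nrm_path μ hμ h hh w m
  have h1 := pow_le_pow_left₀ (Nrm_nonneg μ h _) h0 2
  rw [Nrm_sq μ hμ h hh] at h1
  refine h1.trans ?_
  rw [← sum_c m hm]
  refine Finset.sum_sq_le_sum_mul_sum_of_sq_eq_mul _ ?_ ?_ ?_
  · intro i _; split_ifs <;> norm_num
  · intro i _
    have : 0 ≤ Ixy μ h (w i) (w (i+1)) := integral_nonneg fun _ => sq_nonneg _
    split_ifs <;> positivity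
  · intro i _
    rw [← Nrm_sq μ hμ h hh]
    ring


lemma Ixy_comm (μ : Measure (ℤ → Bool)) (h : (ℤ → Bool) → ℝ) (x y : ℤ) :
    Ixy μ h x y = Ixy μ h y x := by
  simp only [Ixy, swapConf_eq, Equiv.swap_comm x y]

lemma edge_pos (s : ℤ → ℝ) (μ : Measure (ℤ → Bool)) (h : (ℤ → Bool) → ℝ) (a d : ℤ) (hd : 0 < d) :
    ENNReal.ofReal (s d) * ∑' x : ℤ, ENNReal.ofReal (Ixy μ h (x + a) (x + a + d)) ≤
      ∑' x : ℤ, ∑' z : ℕ,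
    ENNReal.ofReal (s ((z : ℤ) + 1)) * ENNReal.ofReal (Ixy μ h x (x + ((z : ℤ) + 1))) := by
  have := (Equiv.addRight a).tsum_eq (fun x : ℤ => ENNReal.ofReal (Ixy μ h x (x + d)))
  simp only [Equiv.coe_addRight] at this
  rw [this, ← ENNReal.tsum_mul_left]
  refine ENNReal.tsum_le_tsum fun x => ?_
  obtain ⟨z, rfl⟩ : ∃ z : ℕ, d = (z : ℤ) + 1 := ⟨(d - 1).toNat, by omega⟩
  exact ENNReal.le_tsum z

lemma edge (s : ℤ → ℝ) (hsym : ∀ z, s (-z) = s z) (μ : Measure (ℤ → Bool))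
    (h : (ℤ → Bool) → ℝ) (a b : ℤ) (hd : a ≠ b) :
    ENNReal.ofReal (s (b - a)) * ∑' x : ℤ, ENNReal.ofReal (Ixy μ h (x + a) (x + b)) ≤
      ∑' x : ℤ, ∑' z : ℕ,
    ENNReal.ofReal (s ((z : ℤ) + 1)) * ENNReal.ofReal (Ixy μ h x (x + ((z : ℤ) + 1))) := by
  rcases lt_or_gt_of_ne hd with hlt | hlt
  · have := edge_pos s μ h a (b - a) (by omega)
    simpa [add_assoc] using this
  · have := edge_pos s μ h b (a - b) (by omega)
    rw [← hsym, neg_sub]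
    simp only [Ixy_comm μ h (_ + a)]
    simpa [add_assoc] using this

/-- Equivalence of Dirichlet forms, second estimate: if there is a path
`x₀ = 0, x₁, …, x_m = 1` with `s(x_i − x_{i−1}) > 0`, then
`𝒟(h) ≤ (4m−3)m / min_i s(x_i − x_{i−1}) ⋅ ⟨h, −Sh⟩`. -/
theorem stmt_7 (s : ℤ → ℝ) (hpos : ∀ z, 0 ≤ s z) (hsym : ∀ z, s (-z) = s z)
    (hzero : s 0 = 0) (hprob : HasSum s 1)
    (μ : Measure (ℤ → Bool)) [IsProbabilityMeasure μ]
    (hμ : ∀ (S : Finset ℤ) (b : ℤ → Bool),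
      μ {η | ∀ x ∈ S, η x = b x} = (1 / 2 : ENNReal) ^ S.card)
    (h : (ℤ → Bool) → ℝ) (hh : MemLp h 2 μ)
    (m : ℕ) (hm : 1 ≤ m) (xseq : ℕ → ℤ) (hx0 : xseq 0 = 0) (hxm : xseq m = 1)
    (hpath : ∀ i : Fin m, 0 < s (xseq (i + 1) - xseq i)) :
    dirichletForm μ h ≤
      ENNReal.ofReal ((4 * (m : ℝ) - 3) * m / ⨅ i : Fin m, s (xseq (i + 1) - xseq i)) *
        genForm s μ h := by
  have hB : IsBern μ := hμ
  unfold dirichletForm genForm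
  set G : ENNReal := ∑' x : ℤ, ∑' z : ℕ,
    ENNReal.ofReal (s ((z : ℤ) + 1)) * ENNReal.ofReal (Ixy μ h x (x + ((z : ℤ) + 1))) with hG
  set M : ℝ := ⨅ i : Fin m, s (xseq (i + 1) - xseq i) with hM
  haveI : Nonempty (Fin m) := ⟨⟨0, hm⟩⟩
  have hMpos : 0 < M := by
    obtain ⟨i, hi⟩ := exists_eq_ciInf_of_finite (f := fun i : Fin m => s (xseq (i + 1) - xseq i))
    rw [hM, ← hi]; exact hpath i
  have hMle : ∀ i < m, M ≤ s (xseq (i + 1) - xseq i) := fun i hi =>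
    ciInf_le (f := fun i : Fin m => s (xseq (i + 1) - xseq i)) (Set.finite_range _).bddBelow ⟨i, hi⟩
  have hm1 : (1 : ℝ) ≤ m := by exact_mod_cast hm
  have hInn : ∀ x y, 0 ≤ Ixy μ h x y := fun x y => integral_nonneg fun _ => sq_nonneg _
  have hcnn : ∀ i : ℕ, (0:ℝ) ≤ (if i = 0 then 1 else 2) := fun i => by split_ifs <;> norm_num
  have hedge : ∀ i < m, ∑' x : ℤ, ENNReal.ofReal (Ixy μ h (x + xseq i) (x + xseq (i+1)))
      ≤ ENNReal.ofReal M⁻¹ * G := by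
    intro i hi
    have hne : xseq i ≠ xseq (i+1) := by
      intro he
      have := hpath ⟨i, hi⟩
      simp [he, hzero] at this
    have h1 := edge s hsym μ h (xseq i) (xseq (i+1)) hne
    rw [← hG] at h1
    have h2 := (mul_le_mul_left (ENNReal.ofReal_le_ofReal (hMle i hi))
      (∑' x : ℤ, ENNReal.ofReal (Ixy μ h (x + xseq i) (x + xseq (i+1))))).trans h1
    calc _ = ENNReal.ofReal M⁻¹ * (ENNReal.ofReal M *
          ∑' x : ℤ, ENNReal.ofReal (Ixy μ h (x + xseq i) (x + xseq (i+1)))) := by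
            rw [← mul_assoc, ← ENNReal.ofReal_mul (by positivity), inv_mul_cancel₀ hMpos.ne']
            simp
      _ ≤ _ := by gcongr
  have key : ∑' x : ℤ, ENNReal.ofReal (Ixy μ h x (x + 1)) ≤
      ENNReal.ofReal ((4 * (m : ℝ) - 3) * m / M) * G := by
    calc ∑' x : ℤ, ENNReal.ofReal (Ixy μ h x (x + 1))
        ≤ ∑' x : ℤ, ENNReal.ofReal (2 * m - 1) * ∑ i ∈ Finset.range m,
            ENNReal.ofReal (if i = 0 then 1 else 2) *
              ENNReal.ofReal (Ixy μ h (x + xseq i) (x + xseq (i+1))) := by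
          refine ENNReal.tsum_le_tsum fun x => ?_
          have := I_path μ hB h hh (fun i => x + xseq i) m hm
          simp only [hx0, hxm, add_zero] at this
          refine (ENNReal.ofReal_le_ofReal this).trans (le_of_eq ?_)
          rw [ENNReal.ofReal_mul (by linarith),
            ENNReal.ofReal_sum_of_nonneg fun i _ => mul_nonneg (hcnn i) (hInn _ _)]
          congr 1
          exact Finset.sum_congr rfl fun i _ => ENNReal.ofReal_mul (hcnn i)
      _ = ENNReal.ofReal (2 * m - 1) * ∑ i ∈ Finset.range m,
            ENNReal.ofReal (if i = 0 then 1 else 2) *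
              ∑' x : ℤ, ENNReal.ofReal (Ixy μ h (x + xseq i) (x + xseq (i+1))) := by
          rw [ENNReal.tsum_mul_left, Summable.tsum_finsetSum fun _ _ => ENNReal.summable]
          simp only [ENNReal.tsum_mul_left]
      _ ≤ ENNReal.ofReal (2 * m - 1) * ∑ i ∈ Finset.range m,
            ENNReal.ofReal (if i = 0 then 1 else 2) * (ENNReal.ofReal M⁻¹ * G) := by
          gcongr with i hi
          exact hedge i (Finset.mem_range.1 hi)
      _ = ENNReal.ofReal ((2 * m - 1) * (2 * m - 1) * M⁻¹) * G := by
          rw [← Finset.sum_mul, ← ENNReal.ofReal_sum_of_nonneg fun i _ => hcnn i, sum_c m hm,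
            ENNReal.ofReal_mul (by nlinarith), ENNReal.ofReal_mul (by linarith)]
          ring
      _ ≤ _ := by
          gcongr
          rw [div_eq_mul_inv]
          gcongr ?_ * _
          nlinarith
  calc _ ≤ (1 / 2 : ENNReal) * (ENNReal.ofReal ((4 * (m : ℝ) - 3) * m / M) * G) := by gcongr
    _ = _ := by ring
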